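/- Let G be a finite simple graph with maximum average degree mad(G) < 6 whose maximum degree satisfies 7 ≤ Δ(G) ≤ 11. Then χ_i(G) ≤ Δ(G) + 7. -/

import Mathlib

open SimpleGraph

/-- An incidence coloring of `G` with `n` colors, where `φ v u` is the color of the
incidence `(v, vu)` (meaningful when `G.Adj v u`): two distinct adjacent incidences
`(v, vu)` and `(w, wx)` receive distinct colors. Incidences `(v, e)` and `(w, f)` are
adjacent if `v = w`, or `e = f`, or the edge `vw` equals `e` or `f`. -/
def IsIncidenceColoring {V : Type*} (G : SimpleGraph V) {n : ℕ} (φ : V → V → Fin n) : Prop :=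
  ∀ ⦃v u w x : V⦄, G.Adj v u → G.Adj w x → (v, u) ≠ (w, x) →
    (v = w ∨ s(v, u) = s(w, x) ∨ s(v, w) = s(v, u) ∨ s(v, w) = s(w, x)) →
    φ v u ≠ φ w x

/-- `G` admits an incidence `(n, ℓ)`-coloring: an incidence coloring with `n` colors such
that for every vertex `v`, at most `ℓ` distinct colors appear on the incidences of the
form `(u, uv)` where `u` ranges over the neighbors of `v`. -/
def HasIncidenceColoring {V : Type*} (G : SimpleGraph V) (n ℓ : ℕ) : Prop :=
  ∃ φ : V → V → Fin n, IsIncidenceColoring G φ ∧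
    ∀ v : V, ({c : Fin n | ∃ u : V, G.Adj u v ∧ φ u v = c}).ncard ≤ ℓ

/-- The incidence chromatic number: the least `n` such that `G` admits an incidence
`n`-coloring. -/
noncomputable def incChromaticNumber {V : Type*} (G : SimpleGraph V) : ℕ :=
  sInf {n : ℕ | ∃ φ : V → V → Fin n, IsIncidenceColoring G φ}

/-- `mad(G) < q`: every nonempty subgraph `H` of `G` satisfies `2|E(H)| < q·|V(H)|`. -/
def MadLT {V : Type*} (G : SimpleGraph V) (q : ℝ) : Prop :=
  ∀ H : G.Subgraph, H.verts.Nonempty →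
    (2 * H.edgeSet.ncard : ℝ) < q * H.verts.ncard

/-- A simultaneous choice of pairwise distinct `x i ∈ A i` and of `y i ∈ M i` such that no `x i`
equals any `y j`. -/
def CompatibleChoice {ι α : Type*} (A M : ι → Finset α) : Prop :=
  ∃ x y : ι → α, Function.Injective x ∧ (∀ i, x i ∈ A i) ∧ (∀ i, y i ∈ M i) ∧ ∀ i j, x i ≠ y j

section CompatibleChoice

variable {α : Type*} [DecidableEq α]

lemma card_le_card_sdiff_image_add {ι : Type*} [Fintype ι] (y : ι → α) (B : Finset α)
    (T : Finset ι) (h : ∀ i, i ∉ T → y i ∉ B) :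
    B.card ≤ (B \ Finset.univ.image y).card + T.card := by
  have hsub : B ⊆ (B \ Finset.univ.image y) ∪ T.image y := by
    intro z hz
    by_cases hzy : z ∈ Finset.univ.image y
    · obtain ⟨i, -, rfl⟩ := Finset.mem_image.1 hzy
      have hi : i ∈ T := by_contra fun hi => h i hi hz
      exact Finset.mem_union_right _ (Finset.mem_image_of_mem y hi)
    · exact Finset.mem_union_left _ (Finset.mem_sdiff.2 ⟨hz, hzy⟩)
  calc B.card ≤ _ := Finset.card_le_card hsub
    _ ≤ _ := Finset.card_union_le _ _
    _ ≤ _ := by have := Finset.card_image_le (s := T) (f := y); omega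

lemma CompatibleChoice.of_hall {ι : Type*} [Fintype ι] {A M : ι → Finset α} (y : ι → α)
    (hy : ∀ i, y i ∈ M i)
    (h : ∀ R : Finset ι, R.Nonempty → R.card ≤ (R.biUnion A \ Finset.univ.image y).card) :
    CompatibleChoice A M := by
  obtain ⟨x, hx, hxA⟩ := (Finset.all_card_le_biUnion_card_iff_exists_injective
    (fun i => A i \ Finset.univ.image y)).1 (by
      intro R
      rcases R.eq_empty_or_nonempty with rfl | hR
      · simp
      · refine (h R hR).trans (Finset.card_le_card ?_)
        intro z hz
        simp only [Finset.mem_sdiff, Finset.mem_biUnion] at hz ⊢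
        obtain ⟨⟨i, hi, hzi⟩, hzy⟩ := hz
        exact ⟨i, hi, hzi, hzy⟩)
  refine ⟨x, y, hx, fun i => (Finset.mem_sdiff.1 (hxA i)).1, hy, fun i j hij => ?_⟩
  exact (Finset.mem_sdiff.1 (hxA i)).2 (hij ▸ Finset.mem_image_of_mem y (Finset.mem_univ j))

variable {A M : Fin 5 → Finset α}

lemma five_le_card_biUnion (hA : ∀ i, (A i).card = 5) {R : Finset (Fin 5)} (hR : R.Nonempty) :
    5 ≤ (R.biUnion A).card := by
  obtain ⟨i, hi⟩ := hR
  exact (hA i).symm.le.trans (Finset.card_le_card (Finset.subset_biUnion_of_mem A hi))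

lemma card_inter_biUnion_add_five_le (hA : ∀ i, (A i).card = 5) (hAM : ∀ i, Disjoint (A i) (M i))
    {R : Finset (Fin 5)} {i : Fin 5} (hi : i ∈ R) :
    (M i ∩ R.biUnion A).card + 5 ≤ (R.biUnion A).card := by
  have h := Finset.card_union_of_disjoint
    (((hAM i).symm).mono_left (Finset.inter_subset_left (s₂ := R.biUnion A)))
  rw [hA i] at h
  rw [← h]
  exact Finset.card_le_card (Finset.union_subset Finset.inter_subset_right
    (Finset.subset_biUnion_of_mem A hi))

lemma eight_le_card_sdiff_biUnion_add (hA : ∀ i, (A i).card = 5) (hM : ∀ i, (M i).card = 3)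
    (hAM : ∀ i, Disjoint (A i) (M i)) {R : Finset (Fin 5)} {i : Fin 5} (hi : i ∈ R) :
    8 ≤ (M i \ R.biUnion A).card + (R.biUnion A).card := by
  have h1 := card_inter_biUnion_add_five_le hA hAM hi
  have h2 := Finset.card_sdiff_add_card_inter (M i) (R.biUnion A)
  have := hM i
  omega

/-- If all the sets indexed by `R` have union of size five, only indices outside `R` can hit it. -/
lemma card_biUnion_le_of_card_eq_five (hA : ∀ i, (A i).card = 5)
    (hAM : ∀ i, Disjoint (A i) (M i)) {y : Fin 5 → α} (hy : ∀ i, y i ∈ M i)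
    {R : Finset (Fin 5)} (hR : (R.biUnion A).card = 5) :
    R.card ≤ (R.biUnion A \ Finset.univ.image y).card := by
  have h := card_le_card_sdiff_image_add y (R.biUnion A) (Finset.univ \ R) (by
    intro i hi hyi
    have hi : i ∈ R := by simpa using hi
    have h1 := card_inter_biUnion_add_five_le hA hAM hi
    have h2 := Finset.card_pos.2 ⟨y i, Finset.mem_inter.2 ⟨hy i, hyi⟩⟩
    omega)
  have h2 := Finset.card_sdiff_add_card_eq_card (Finset.subset_univ R)
  simp only [Finset.card_univ, Fintype.card_fin] at h2
  omega

lemma one_le_card_sdiff_image (hA : ∀ i, (A i).card = 5) (hAM : ∀ i, Disjoint (A i) (M i))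
    {y : Fin 5 → α} (hy : ∀ i, y i ∈ M i) {R : Finset (Fin 5)} (hR : R.card = 1) :
    R.card ≤ (R.biUnion A \ Finset.univ.image y).card := by
  obtain ⟨i, rfl⟩ := Finset.card_eq_one.1 hR
  exact card_biUnion_le_of_card_eq_five hA hAM hy (by simpa using hA i)

lemma card_biUnion_univ_le_add_five (hA : ∀ i, (A i).card = 5) {R : Finset (Fin 5)}
    (hR : R.card = 4) : (Finset.univ.biUnion A).card ≤ (R.biUnion A).card + 5 := by
  obtain ⟨o, ho⟩ : ∃ o, insert o R = Finset.univ := by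
    obtain ⟨o, ho⟩ := Finset.card_eq_one.1 (show (Rᶜ).card = 1 by rw [Finset.card_compl, hR]; rfl)
    exact ⟨o, by rw [Finset.insert_eq, ← ho, Finset.union_comm, Finset.union_compl]⟩
  rw [← ho, Finset.biUnion_insert]
  refine (Finset.card_union_le _ _).trans ?_
  rw [hA o]; omega

lemma CompatibleChoice.of_card_biUnion_univ_le (hA : ∀ i, (A i).card = 5)
    (hM : ∀ i, (M i).card = 3) (hAM : ∀ i, Disjoint (A i) (M i))
    (h : (Finset.univ.biUnion A).card ≤ 7) : CompatibleChoice A M := by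
  have hex : ∀ i, ∃ z, z ∈ M i \ Finset.univ.biUnion A := by
    intro i
    have := eight_le_card_sdiff_biUnion_add hA hM hAM (Finset.mem_univ i)
    exact Finset.card_pos.1 (by omega)
  choose y hy using hex
  refine .of_hall y (fun i => (Finset.mem_sdiff.1 (hy i)).1) fun R hR => ?_
  have h1 := card_le_card_sdiff_image_add y (R.biUnion A) ∅ (by
    intro i _ hi
    exact (Finset.mem_sdiff.1 (hy i)).2
      (Finset.biUnion_subset_biUnion_of_subset_left A (Finset.subset_univ R) hi))
  have h2 := five_le_card_biUnion hA hR
  have h3 := R.card_le_univ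
  simp only [Fintype.card_fin, Finset.card_empty] at h1 h3
  omega

lemma CompatibleChoice.of_card_biUnion_four_le (hA : ∀ i, (A i).card = 5)
    (hM : ∀ i, (M i).card = 3) (hAM : ∀ i, Disjoint (A i) (M i))
    (hU : 8 ≤ (Finset.univ.biUnion A).card) {S : Finset (Fin 5)} (hS : S.card = 4)
    (h : (S.biUnion A).card ≤ 7) : CompatibleChoice A M := by
  obtain ⟨o, ho⟩ := Finset.card_eq_one.1 (show (Sᶜ).card = 1 by rw [Finset.card_compl, hS]; rfl)
  have hmem : ∀ i, i ∈ S ↔ i ≠ o := by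
    intro i
    have : i ∈ Sᶜ ↔ i = o := by rw [ho]; simp
    rw [Finset.mem_compl] at this
    tauto
  have hSne : S.Nonempty := Finset.card_pos.1 (by omega)
  have h5 := five_le_card_biUnion hA hSne
  obtain ⟨p, hp, hpS⟩ : ∃ p ∈ A o, p ∉ S.biUnion A := by
    by_contra! hcon
    have : Finset.univ.biUnion A ⊆ S.biUnion A := by
      intro z hz
      obtain ⟨i, -, hzi⟩ := Finset.mem_biUnion.1 hz
      by_cases hi : i = o
      · exact hcon z (hi ▸ hzi)
      · exact Finset.mem_biUnion.2 ⟨i, (hmem i).2 hi, hzi⟩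
    have := Finset.card_le_card this
    omega
  have hex : ∀ i, ∃ z ∈ M i, i ∈ S → z ∉ S.biUnion A ∧ ((S.biUnion A).card = 5 → z ≠ p) := by
    intro i
    by_cases hi : i ∈ S
    · have h8 := eight_le_card_sdiff_biUnion_add hA hM hAM hi
      by_cases hc : (S.biUnion A).card = 5
      · obtain ⟨z, hz, hzp⟩ := Finset.exists_mem_ne
          (show 1 < (M i \ S.biUnion A).card by omega) p
        exact ⟨z, (Finset.mem_sdiff.1 hz).1, fun _ => ⟨(Finset.mem_sdiff.1 hz).2, fun _ => hzp⟩⟩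
      · obtain ⟨z, hz⟩ := Finset.card_pos.1 (show 0 < (M i \ S.biUnion A).card by omega)
        exact ⟨z, (Finset.mem_sdiff.1 hz).1,
          fun _ => ⟨(Finset.mem_sdiff.1 hz).2, fun h => absurd h hc⟩⟩
    · obtain ⟨z, hz⟩ := Finset.card_pos.1 (show 0 < (M i).card by rw [hM i]; omega)
      exact ⟨z, hz, fun h => absurd h hi⟩
  choose y hyM hyS using hex
  have hout : ∀ i, i ∉ ({o} : Finset (Fin 5)) → y i ∉ S.biUnion A := by
    intro i hi
    exact (hyS i ((hmem i).2 (by simpa using hi))).1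
  refine .of_hall y hyM fun R hR => ?_
  have hRle := R.card_le_univ
  rw [Fintype.card_fin] at hRle
  by_cases hR5 : R.card = 5
  · have hRu : R = Finset.univ := (Finset.card_eq_iff_eq_univ R).1 (by simpa using hR5)
    subst hRu
    have h1 := card_le_card_sdiff_image_add y _ _ hout
    have hsub : S.biUnion A \ Finset.univ.image y ⊆ Finset.univ.biUnion A \ Finset.univ.image y :=
      Finset.sdiff_subset_sdiff
        (Finset.biUnion_subset_biUnion_of_subset_left A (Finset.subset_univ S)) subset_rfl
    rw [Finset.card_singleton] at h1
    by_cases hc : (S.biUnion A).card = 5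
    · have hpn : p ∉ Finset.univ.image y := by
        intro hpy
        obtain ⟨i, -, rfl⟩ := Finset.mem_image.1 hpy
        by_cases hi : i = o
        · exact Finset.disjoint_left.1 (hAM i) (hi ▸ hp) (hyM i)
        · exact (hyS i ((hmem i).2 hi)).2 hc rfl
      have hlt := Finset.card_lt_card (Finset.ssubset_iff_of_subset hsub |>.2
        ⟨p, Finset.mem_sdiff.2 ⟨Finset.mem_biUnion.2 ⟨o, Finset.mem_univ o, hp⟩, hpn⟩,
          fun hp' => hpS (Finset.mem_sdiff.1 hp').1⟩)
      omega
    · have := Finset.card_le_card hsub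
      omega
  · by_cases hRo : R = {o}
    · exact one_le_card_sdiff_image hA hAM hyM (by rw [hRo]; simp)
    · obtain ⟨i, hi, hio⟩ : ∃ i ∈ R, i ≠ o := by
        by_contra! hcon
        exact hRo (Finset.eq_singleton_iff_nonempty_unique_mem.2 ⟨hR, hcon⟩)
      have hiS := (hmem i).2 hio
      have h1 := card_le_card_sdiff_image_add y (A i) {o} (fun j hj hyj =>
        hout j hj (Finset.subset_biUnion_of_mem A hiS hyj))
      have h2 : (A i \ Finset.univ.image y).card ≤ (R.biUnion A \ Finset.univ.image y).card :=
        Finset.card_le_card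
          (Finset.sdiff_subset_sdiff (Finset.subset_biUnion_of_mem A hi) subset_rfl)
      rw [hA i, Finset.card_singleton] at h1
      omega

lemma card_biUnion_le_sdiff_add_inter (y : Fin 5 → α) (R : Finset (Fin 5)) :
    (R.biUnion A).card ≤ (R.biUnion A \ Finset.univ.image y).card +
      (Finset.univ.biUnion A ∩ Finset.univ.image y).card := by
  rw [← Finset.card_sdiff_add_card_inter (R.biUnion A) (Finset.univ.image y)]
  exact Nat.add_le_add_left (Finset.card_le_card (Finset.inter_subset_inter_right
    (Finset.biUnion_subset_biUnion_of_subset_left A (Finset.subset_univ R)))) _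

lemma CompatibleChoice.of_card_inter_le_three (hA : ∀ i, (A i).card = 5)
    (hAM : ∀ i, Disjoint (A i) (M i)) (hU : 8 ≤ (Finset.univ.biUnion A).card)
    (h4 : ∀ R : Finset (Fin 5), R.card = 4 → 8 ≤ (R.biUnion A).card)
    (y : Fin 5 → α) (hy : ∀ i, y i ∈ M i)
    (h : (Finset.univ.biUnion A ∩ Finset.univ.image y).card ≤ 3) : CompatibleChoice A M := by
  refine .of_hall y hy fun R hR => ?_
  have hRle := R.card_le_univ
  rw [Fintype.card_fin] at hRle
  have h1 := card_biUnion_le_sdiff_add_inter (A := A) y R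
  have h5 := five_le_card_biUnion hA hR
  by_cases hR5 : R.card = 5
  · have hRu : R = Finset.univ := (Finset.card_eq_iff_eq_univ R).1 (by simpa using hR5)
    subst hRu
    omega
  by_cases hR4 : R.card = 4
  · have := h4 R hR4
    omega
  by_cases hc : (R.biUnion A).card = 5
  · exact card_biUnion_le_of_card_eq_five hA hAM hy hc
  · omega

lemma CompatibleChoice.of_card_inter_le_four (hA : ∀ i, (A i).card = 5)
    (hAM : ∀ i, Disjoint (A i) (M i)) (hU : 9 ≤ (Finset.univ.biUnion A).card)
    (h4 : ∀ R : Finset (Fin 5), R.card = 4 → 8 ≤ (R.biUnion A).card)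
    (h3 : ∀ R : Finset (Fin 5), R.card = 3 → 7 ≤ (R.biUnion A).card)
    (y : Fin 5 → α) (hy : ∀ i, y i ∈ M i)
    (h : (Finset.univ.biUnion A ∩ Finset.univ.image y).card ≤ 4) : CompatibleChoice A M := by
  refine .of_hall y hy fun R hR => ?_
  have hRle := R.card_le_univ
  rw [Fintype.card_fin] at hRle
  have h1 := card_biUnion_le_sdiff_add_inter (A := A) y R
  have h5 := five_le_card_biUnion hA hR
  by_cases hR5 : R.card = 5
  · have hRu : R = Finset.univ := (Finset.card_eq_iff_eq_univ R).1 (by simpa using hR5)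
    subst hRu
    omega
  by_cases hR4 : R.card = 4
  · have := h4 R hR4
    omega
  by_cases hR3 : R.card = 3
  · have := h3 R hR3
    omega
  by_cases hc : (R.biUnion A).card = 5
  · exact card_biUnion_le_of_card_eq_five hA hAM hy hc
  · omega

/-- If the sets `M i` with `i ∈ T` are too large to be pairwise disjoint inside `U`, then some of
them can be represented by one element at a reduced cost in `U`. -/
lemma exists_shared_representative (hM : ∀ i, (M i).card = 3) (U : Finset α)
    (T : Finset (Fin 5)) (hT : U.card < 3 * T.card) :
    ∃ P ⊆ T, ∃ z, (∀ i ∈ P, z ∈ M i) ∧ ({z} ∩ U).card + 1 ≤ P.card := by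
  by_contra! hcon
  have hsub : ∀ i ∈ T, M i ⊆ U := by
    intro i hi z hz
    by_contra hzU
    have := hcon {i} (by simpa using hi) z (by simpa using hz)
    rw [Finset.singleton_inter_of_notMem hzU] at this
    simp at this
  have hdisj : ∀ i ∈ T, ∀ j ∈ T, i ≠ j → Disjoint (M i) (M j) := by
    intro i hi j hj hij
    rw [Finset.disjoint_left]
    intro z hzi hzj
    have := hcon {i, j} (by simp [Finset.insert_subset_iff, hi, hj]) z (by simp [hzi, hzj])
    rw [Finset.card_pair hij] at this
    have := Finset.card_le_card (Finset.inter_subset_left (s₁ := {z}) (s₂ := U))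
    simp at this
    omega
  have h1 := Finset.card_biUnion hdisj
  have h2 := Finset.card_le_card (Finset.biUnion_subset.2 hsub)
  rw [h1] at h2
  simp [hM] at h2
  omega

lemma exists_card_inter_le_four (hM : ∀ i, (M i).card = 3) (U : Finset α) (hU : U.card < 15) :
    ∃ y : Fin 5 → α, (∀ i, y i ∈ M i) ∧ (U ∩ Finset.univ.image y).card ≤ 4 := by
  obtain ⟨P, -, z, hz, hc⟩ := exists_shared_representative hM U Finset.univ (by simpa using hU)
  have hne : ∀ i, ∃ w, w ∈ M i := fun i => Finset.card_pos.1 (by rw [hM i]; omega)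
  choose w hw using hne
  refine ⟨fun i => if i ∈ P then z else w i, fun i => ?_, ?_⟩
  · dsimp only
    split_ifs with h
    exacts [hz i h, hw i]
  · have hsub : U ∩ Finset.univ.image (fun i => if i ∈ P then z else w i) ⊆
        ({z} ∩ U) ∪ Pᶜ.image w := by
      intro t ht
      obtain ⟨htU, ht⟩ := Finset.mem_inter.1 ht
      obtain ⟨i, -, rfl⟩ := Finset.mem_image.1 ht
      by_cases h : i ∈ P
      · simp_all
      · exact Finset.mem_union_right _ (Finset.mem_image.2 ⟨i, by simpa using h, by simp [h]⟩)
    have h1 := (Finset.card_le_card hsub).trans (Finset.card_union_le _ _)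
    have h2 := Finset.card_image_le (s := Pᶜ) (f := w)
    have h3 := Finset.card_add_card_compl P
    rw [Fintype.card_fin] at h3
    omega

lemma exists_card_inter_le_three (hM : ∀ i, (M i).card = 3) (U : Finset α) (hU : U.card < 9) :
    ∃ y : Fin 5 → α, (∀ i, y i ∈ M i) ∧ (U ∩ Finset.univ.image y).card ≤ 3 := by
  have key : ∀ T : Finset (Fin 5), 3 ≤ T.card →
      ∃ P ⊆ T, P.card ≤ 2 ∧ ∃ z, (∀ i ∈ P, z ∈ M i) ∧ ({z} ∩ U).card + 1 ≤ P.card := by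
    intro T hT
    obtain ⟨P, hP, z, hz, hc⟩ := exists_shared_representative hM U T (by omega)
    have hz1 := Finset.card_le_card (Finset.inter_subset_left (s₁ := {z}) (s₂ := U))
    rw [Finset.card_singleton] at hz1
    obtain ⟨Q, hQP, hQ⟩ := Finset.exists_subset_card_eq hc
    exact ⟨Q, hQP.trans hP, by omega, z, fun i hi => hz i (hQP hi), hQ.ge⟩
  obtain ⟨P, -, hP2, z, hz, hc⟩ := key Finset.univ (by simp)
  have h3 := Finset.card_add_card_compl P
  rw [Fintype.card_fin] at h3
  obtain ⟨Q, hQ, -, z', hz', hc'⟩ := key Pᶜ (by omega)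
  have hne : ∀ i, ∃ w, w ∈ M i := fun i => Finset.card_pos.1 (by rw [hM i]; omega)
  choose w hw using hne
  refine ⟨fun i => if i ∈ P then z else if i ∈ Q then z' else w i, fun i => ?_, ?_⟩
  · dsimp only
    split_ifs with h h'
    exacts [hz i h, hz' i h', hw i]
  · have hsub : U ∩ Finset.univ.image (fun i => if i ∈ P then z else if i ∈ Q then z' else w i) ⊆
        ({z} ∩ U) ∪ (({z'} ∩ U) ∪ (Pᶜ \ Q).image w) := by
      intro t ht
      obtain ⟨htU, ht⟩ := Finset.mem_inter.1 ht
      obtain ⟨i, -, rfl⟩ := Finset.mem_image.1 ht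
      by_cases h : i ∈ P
      · simp_all
      · by_cases h' : i ∈ Q
        · simp_all
        · exact Finset.mem_union_right _ (Finset.mem_union_right _
            (Finset.mem_image.2 ⟨i, by simp [h, h'], by simp [h, h']⟩))
    have h1 := (Finset.card_le_card hsub).trans (Finset.card_union_le _ _)
    have h2 := Finset.card_union_le ({z'} ∩ U) ((Pᶜ \ Q).image w)
    have h4 := Finset.card_image_le (s := Pᶜ \ Q) (f := w)
    have h5 := Finset.card_sdiff_add_card_eq_card hQ
    omega

lemma CompatibleChoice.of_fifteen_le (hA : ∀ i, (A i).card = 5) (hM : ∀ i, (M i).card = 3)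
    (hAM : ∀ i, Disjoint (A i) (M i)) (hU : 15 ≤ (Finset.univ.biUnion A).card) :
    CompatibleChoice A M := by
  have h4 : ∀ R : Finset (Fin 5), 4 ≤ R.card → 10 ≤ (R.biUnion A).card := by
    intro R hR
    obtain ⟨Q, hQR, hQ⟩ := Finset.exists_subset_card_eq hR
    have h1 := card_biUnion_univ_le_add_five hA hQ
    have h2 := Finset.card_le_card (Finset.biUnion_subset_biUnion_of_subset_left A hQR)
    omega
  have hmax : ∀ i, ∃ R : Finset (Fin 5), i ∈ R ∧ (R.biUnion A).card ≤ R.card + 4 ∧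
      ∀ Q : Finset (Fin 5), i ∈ Q → (Q.biUnion A).card ≤ Q.card + 4 → Q.card ≤ R.card := by
    intro i
    obtain ⟨R, hR, hRmax⟩ := Finset.exists_max_image
      (Finset.univ.filter fun R : Finset (Fin 5) => i ∈ R ∧ (R.biUnion A).card ≤ R.card + 4)
      Finset.card ⟨{i}, by simp [hA i]⟩
    simp only [Finset.mem_filter, Finset.mem_univ, true_and] at hR hRmax
    exact ⟨R, hR.1, hR.2, fun Q h1 h2 => hRmax Q ⟨h1, h2⟩⟩
  choose R hiR hR hRmax using hmax
  have hR3 : ∀ i, (R i).card ≤ 3 := by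
    intro i
    by_contra! hlt
    have h1 := h4 (R i) hlt
    have h2 := hR i
    have h3 := (R i).card_le_univ
    rw [Fintype.card_fin] at h3
    omega
  have hsub : ∀ i, ∀ Q : Finset (Fin 5), i ∈ Q → (Q.biUnion A).card ≤ Q.card + 4 → Q ⊆ R i := by
    intro i Q hiQ hQ
    have hQc := hRmax i Q hiQ hQ
    have hRi := hR i
    have hR3i := hR3 i
    have hle : (((R i) ∪ Q).biUnion A).card + 5 ≤ ((R i).biUnion A).card + (Q.biUnion A).card := by
      rw [Finset.union_biUnion, ← Finset.card_union_add_card_inter]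
      refine Nat.add_le_add_left ((hA i).symm.le.trans (Finset.card_le_card ?_)) _
      exact Finset.subset_inter (Finset.subset_biUnion_of_mem A (hiR i))
        (Finset.subset_biUnion_of_mem A hiQ)
    have hu3 : ((R i) ∪ Q).card ≤ 3 := by
      by_contra! hlt
      have := h4 _ hlt
      omega
    by_contra hns
    have hlt : (R i).card < ((R i) ∪ Q).card := Finset.card_lt_card
      (Finset.ssubset_iff_subset_ne.2 ⟨Finset.subset_union_left, fun h => hns
        (h ▸ Finset.subset_union_right)⟩)
    have := hRmax i ((R i) ∪ Q) (Finset.mem_union_left _ (hiR i)) (by omega)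
    omega
  have hex : ∀ i, ∃ z, z ∈ M i \ (R i).biUnion A := by
    intro i
    have h1 := eight_le_card_sdiff_biUnion_add hA hM hAM (hiR i)
    have h2 := hR i
    have h3 := hR3 i
    exact Finset.card_pos.1 (by omega)
  choose y hy using hex
  refine .of_hall y (fun i => (Finset.mem_sdiff.1 (hy i)).1) fun Q hQ => ?_
  have hQle := Q.card_le_univ
  rw [Fintype.card_fin] at hQle
  by_cases hbad : (Q.biUnion A).card ≤ Q.card + 4
  · have h1 := card_le_card_sdiff_image_add y (Q.biUnion A) Qᶜ (by
      intro i hi hyi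
      have hiQ : i ∈ Q := by simpa using hi
      exact (Finset.mem_sdiff.1 (hy i)).2
        (Finset.biUnion_subset_biUnion_of_subset_left A (hsub i Q hiQ hbad) hyi))
    have h2 := Finset.card_add_card_compl Q
    rw [Fintype.card_fin] at h2
    have h3 := five_le_card_biUnion hA hQ
    omega
  · have h1 := card_le_card_sdiff_image_add y (Q.biUnion A) Finset.univ (by simp)
    rw [Finset.card_univ, Fintype.card_fin] at h1
    omega

lemma CompatibleChoice.of_card_biUnion_three_le (hA : ∀ i, (A i).card = 5)
    (hM : ∀ i, (M i).card = 3) (hAM : ∀ i, Disjoint (A i) (M i))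
    (hU : 9 ≤ (Finset.univ.biUnion A).card)
    (h4 : ∀ R : Finset (Fin 5), R.card = 4 → 8 ≤ (R.biUnion A).card)
    {S : Finset (Fin 5)} (hS : S.card = 3) (h : (S.biUnion A).card ≤ 6) :
    CompatibleChoice A M := by
  obtain ⟨a, b, hab, hSc⟩ := Finset.card_eq_two.1
    (show (Sᶜ).card = 2 by rw [Finset.card_compl, hS]; rfl)
  have hmem : ∀ i, i ∈ S ↔ i ≠ a ∧ i ≠ b := by
    intro i
    have : i ∈ Sᶜ ↔ i = a ∨ i = b := by rw [hSc]; simp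
    rw [Finset.mem_compl] at this
    tauto
  have hSne : S.Nonempty := Finset.card_pos.1 (by omega)
  have h5 := five_le_card_biUnion hA hSne
  have hout : ∀ o, o ∉ S → 2 ≤ (A o \ S.biUnion A).card := by
    intro o ho
    have h1 := h4 (insert o S) (by rw [Finset.card_insert_of_notMem ho, hS])
    rw [Finset.biUnion_insert, ← Finset.sdiff_union_self_eq_union] at h1
    have h2 := Finset.card_union_le (A o \ S.biUnion A) (S.biUnion A)
    omega
  have haS : a ∉ S := by simp [hmem]
  have hbS : b ∉ S := by simp [hmem]
  have hU2 : Finset.univ.biUnion A ⊆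
      S.biUnion A ∪ ((A a \ S.biUnion A) ∪ (A b \ S.biUnion A)) := by
    intro z hz
    obtain ⟨i, -, hzi⟩ := Finset.mem_biUnion.1 hz
    by_cases hzS : z ∈ S.biUnion A
    · exact Finset.mem_union_left _ hzS
    · have hi : i ∉ S := fun hi => hzS (Finset.mem_biUnion.2 ⟨i, hi, hzi⟩)
      have : i = a ∨ i = b := by by_contra hc; exact hi ((hmem i).2 (by tauto))
      rcases this with rfl | rfl <;> simp [hzi, hzS]
  have hPQ : 3 ≤ ((A a \ S.biUnion A) ∪ (A b \ S.biUnion A)).card := by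
    have h1 := (Finset.card_le_card hU2).trans (Finset.card_union_le _ _)
    omega
  have hP2 := hout a haS
  have hQ2 := hout b hbS
  set P := A a \ S.biUnion A
  set Q := A b \ S.biUnion A
  -- the indices of `S` blocked by a pair of representatives
  let bad : Finset α → Finset (Fin 5) := fun e => S.filter fun i => M i \ S.biUnion A ⊆ e
  have hbad : ∀ e e' : Finset α, (e ∩ e').card ≤ 1 → (bad e).card ≤ 1 ∨ (bad e').card ≤ 1 := by
    intro e e' he
    by_contra! hlt
    have h1 := Finset.card_union_add_card_inter (bad e) (bad e')
    have h2 : (bad e ∪ bad e').card ≤ S.card := Finset.card_le_card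
      (Finset.union_subset (Finset.filter_subset _ _) (Finset.filter_subset _ _))
    obtain ⟨k, hk⟩ := Finset.card_pos.1 (show 0 < (bad e ∩ bad e').card by omega)
    simp only [bad, Finset.mem_inter, Finset.mem_filter] at hk
    have h3 := Finset.card_le_card (Finset.subset_inter hk.1.2 hk.2.2)
    have h4 := eight_le_card_sdiff_biUnion_add hA hM hAM hk.1.1
    omega
  obtain ⟨p, hp, r, hr, hpr, hbadpr⟩ : ∃ p ∈ P, ∃ r ∈ Q, p ≠ r ∧ (bad {p, r}).card ≤ 1 := by
    obtain ⟨p, hp⟩ := Finset.card_pos.1 (show 0 < P.card by omega)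
    obtain ⟨r, hr, hrp⟩ := Finset.exists_mem_ne (show 1 < Q.card by omega) p
    obtain ⟨t, ht, htpr⟩ := Finset.exists_mem_notMem_of_card_lt_card
      (show ({p, r} : Finset α).card < (P ∪ Q).card by rw [Finset.card_pair hrp.symm]; omega)
    simp only [Finset.mem_insert, Finset.mem_singleton, not_or] at htpr
    rcases Finset.mem_union.1 ht with ht | ht
    · rcases hbad {p, r} {t, r} (by
        refine (Finset.card_le_card (t := {r}) ?_).trans (by simp)
        intro s hs
        simp only [Finset.mem_inter, Finset.mem_insert, Finset.mem_singleton] at hs ⊢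
        grind) with hb | hb
      · exact ⟨p, hp, r, hr, hrp.symm, hb⟩
      · exact ⟨t, ht, r, hr, htpr.2, hb⟩
    · rcases hbad {p, r} {p, t} (by
        refine (Finset.card_le_card (t := {p}) ?_).trans (by simp)
        intro s hs
        simp only [Finset.mem_inter, Finset.mem_insert, Finset.mem_singleton] at hs ⊢
        grind) with hb | hb
      · exact ⟨p, hp, r, hr, hrp.symm, hb⟩
      · exact ⟨p, hp, t, ht, Ne.symm htpr.1, hb⟩
  have hex : ∀ i, ∃ z ∈ M i, z ∉ ({p, r} : Finset α) ∧
      (i ∈ S → i ∉ bad {p, r} → z ∉ S.biUnion A) := by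
    intro i
    by_cases hi : i ∈ S ∧ i ∉ bad {p, r}
    · have h1 : ¬ M i \ S.biUnion A ⊆ {p, r} := by
        intro hc
        exact hi.2 (Finset.mem_filter.2 ⟨hi.1, hc⟩)
      obtain ⟨z, hz, hzpr⟩ := Finset.not_subset.1 h1
      exact ⟨z, (Finset.mem_sdiff.1 hz).1, hzpr, fun _ _ => (Finset.mem_sdiff.1 hz).2⟩
    · obtain ⟨z, hz, hzpr⟩ := Finset.exists_mem_notMem_of_card_lt_card
        (show ({p, r} : Finset α).card < (M i).card by rw [Finset.card_pair hpr, hM]; omega)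
      exact ⟨z, hz, hzpr, fun h1 h2 => absurd ⟨h1, h2⟩ hi⟩
  choose y hyM hypr hyS using hex
  have hp' := Finset.mem_sdiff.1 hp
  have hr' := Finset.mem_sdiff.1 hr
  have hpy : p ∉ Finset.univ.image y := by
    intro hpy
    obtain ⟨i, -, hi⟩ := Finset.mem_image.1 hpy
    exact hypr i (by simp [hi])
  have hry : r ∉ Finset.univ.image y := by
    intro hry
    obtain ⟨i, -, hi⟩ := Finset.mem_image.1 hry
    exact hypr i (by simp [hi])
  have hin : ∀ R ⊆ S, R.Nonempty → R.card ≤ (R.biUnion A \ Finset.univ.image y).card := by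
    intro R hRS hR
    have hRc := Finset.card_le_card hRS
    have hRU : (R.biUnion A).card ≤ (S.biUnion A).card :=
      Finset.card_le_card (Finset.biUnion_subset_biUnion_of_subset_left A hRS)
    have h5R := five_le_card_biUnion hA hR
    by_cases hc : (R.biUnion A).card = 5
    · exact card_biUnion_le_of_card_eq_five hA hAM hyM hc
    · have h1 := card_le_card_sdiff_image_add y (R.biUnion A) (Sᶜ ∪ bad {p, r}) (by
        intro i hi hyi
        simp only [Finset.mem_union, Finset.mem_compl, not_or, not_not] at hi
        exact hyS i hi.1 hi.2 (Finset.biUnion_subset_biUnion_of_subset_left A hRS hyi))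
      have h2 := Finset.card_union_le Sᶜ (bad {p, r})
      have h3 := Finset.card_add_card_compl S
      rw [Fintype.card_fin] at h3
      omega
  refine .of_hall y hyM fun R hR => ?_
  have hbase : (R ∩ S).card ≤ ((R ∩ S).biUnion A \ Finset.univ.image y).card := by
    rcases (R ∩ S).eq_empty_or_nonempty with he | hne
    · simp [he]
    · exact hin _ Finset.inter_subset_right hne
  let f : Fin 5 → α := fun i => if i = a then p else r
  have hf : (R \ S).card = ((R \ S).image f).card := by
    refine (Finset.card_image_of_injOn ?_).symm
    intro i hi j hj hij
    have hi : i = a ∨ i = b := by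
      have := (Finset.mem_sdiff.1 (Finset.mem_coe.1 hi)).2
      rw [hmem] at this; tauto
    have hj : j = a ∨ j = b := by
      have := (Finset.mem_sdiff.1 (Finset.mem_coe.1 hj)).2
      rw [hmem] at this; tauto
    simp only [f] at hij
    grind
  have hdisj : Disjoint ((R ∩ S).biUnion A \ Finset.univ.image y) ((R \ S).image f) := by
    rw [Finset.disjoint_left]
    intro z hz hzf
    have hzS := Finset.biUnion_subset_biUnion_of_subset_left A Finset.inter_subset_right
      (Finset.mem_sdiff.1 hz).1
    obtain ⟨i, -, rfl⟩ := Finset.mem_image.1 hzf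
    simp only [f] at hzS
    split_ifs at hzS
    exacts [hp'.2 hzS, hr'.2 hzS]
  have hsub : ((R ∩ S).biUnion A \ Finset.univ.image y) ∪ ((R \ S).image f) ⊆
      R.biUnion A \ Finset.univ.image y := by
    refine Finset.union_subset (Finset.sdiff_subset_sdiff
      (Finset.biUnion_subset_biUnion_of_subset_left A Finset.inter_subset_left) subset_rfl) ?_
    intro z hz
    obtain ⟨i, hi, rfl⟩ := Finset.mem_image.1 hz
    obtain ⟨hiR, hiS⟩ := Finset.mem_sdiff.1 hi
    rw [hmem] at hiS
    simp only [f]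
    split_ifs with hia
    · exact Finset.mem_sdiff.2 ⟨Finset.mem_biUnion.2 ⟨i, hiR, hia ▸ hp'.1⟩, hpy⟩
    · have hib : i = b := by tauto
      exact Finset.mem_sdiff.2 ⟨Finset.mem_biUnion.2 ⟨i, hiR, hib ▸ hr'.1⟩, hry⟩
  have h1 := Finset.card_le_card hsub
  rw [Finset.card_union_of_disjoint hdisj, ← hf] at h1
  have h2 := Finset.card_sdiff_add_card_inter R S
  omega

theorem CompatibleChoice.of_card (hA : ∀ i, (A i).card = 5) (hM : ∀ i, (M i).card = 3)
    (hAM : ∀ i, Disjoint (A i) (M i)) : CompatibleChoice A M := by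
  rcases Nat.lt_or_ge (Finset.univ.biUnion A).card 8 with hU | hU
  · exact .of_card_biUnion_univ_le hA hM hAM (by omega)
  by_cases h4 : ∀ R : Finset (Fin 5), R.card = 4 → 8 ≤ (R.biUnion A).card
  swap
  · push Not at h4
    obtain ⟨S, hS, h⟩ := h4
    exact .of_card_biUnion_four_le hA hM hAM hU hS (by omega)
  rcases Nat.lt_or_ge (Finset.univ.biUnion A).card 9 with hU9 | hU9
  · obtain ⟨y, hy, h⟩ := exists_card_inter_le_three hM _ hU9
    exact .of_card_inter_le_three hA hAM hU h4 y hy h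
  by_cases h3 : ∀ R : Finset (Fin 5), R.card = 3 → 7 ≤ (R.biUnion A).card
  swap
  · push Not at h3
    obtain ⟨S, hS, h⟩ := h3
    exact .of_card_biUnion_three_le hA hM hAM hU9 h4 hS (by omega)
  rcases Nat.lt_or_ge (Finset.univ.biUnion A).card 15 with hU15 | hU15
  · obtain ⟨y, hy, h⟩ := exists_card_inter_le_four hM _ hU15
    exact .of_card_inter_le_four hA hAM hU9 h4 h3 y hy h
  · exact .of_fifteen_le hA hM hAM hU15

lemma CompatibleChoice.of_card_of_card_le_five {ι : Type*} [Fintype ι]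
    (hι : Fintype.card ι ≤ 5) {A M : ι → Finset α} (hA : ∀ i, (A i).card = 5)
    (hM : ∀ i, (M i).card = 3) (hAM : ∀ i, Disjoint (A i) (M i)) : CompatibleChoice A M := by
  rcases isEmpty_or_nonempty ι with he | hne
  · exact ⟨isEmptyElim, isEmptyElim, fun i => isEmptyElim i, isEmptyElim, isEmptyElim,
      isEmptyElim⟩
  obtain ⟨e⟩ : Nonempty (ι ↪ Fin 5) := Function.Embedding.nonempty_of_card_le (by simpa using hι)
  obtain ⟨x, y, hx, hxA, hyM, hxy⟩ := CompatibleChoice.of_card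
    (A := A ∘ Function.invFun e) (M := M ∘ Function.invFun e)
    (fun i => hA _) (fun i => hM _) (fun i => hAM _)
  have hinv := Function.leftInverse_invFun e.injective
  refine ⟨x ∘ e, y ∘ e, hx.comp e.injective, fun i => ?_, fun i => ?_, fun i j => hxy _ _⟩
  · simpa [hinv i] using hxA (e i)
  · simpa [hinv i] using hyM (e i)

end CompatibleChoice

section Degeneracy

variable {V : Type*} [DecidableEq V] {G : SimpleGraph V} [DecidableRel G.Adj]

lemma MadLT.exists_degree_le_five (hmad : MadLT G 6) {W : Finset V} (hW : W.Nonempty) :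
    ∃ v ∈ W, (W.filter (G.Adj v)).card ≤ 5 := by
  by_contra! hcon
  let H : G.Subgraph := (⊤ : G.Subgraph).induce (W : Set V)
  have hH := hmad H (by simpa [H] using hW)
  let D : Finset (V × V) := (W ×ˢ W).filter fun p => G.Adj p.1 p.2
  let f : V × V → Sym2 V := fun p => s(p.1, p.2)
  have hD : 6 * W.card ≤ D.card := by
    have h1 : D.card = ∑ v ∈ W, (W.filter (G.Adj v)).card := by
      simp only [D, Finset.card_filter, Finset.sum_product]
    rw [h1, mul_comm, ← smul_eq_mul]
    exact Finset.card_nsmul_le_sum W _ 6 fun v hv => hcon v hv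
  have hE : D.card ≤ 2 * (D.image f).card := by
    refine Finset.card_le_mul_card_image D 2 fun e he => ?_
    obtain ⟨⟨a, b⟩, -, rfl⟩ := Finset.mem_image.1 he
    refine (Finset.card_le_card (t := {(a, b), (b, a)}) ?_).trans Finset.card_le_two
    rintro ⟨c, d⟩ hcd
    have := (Finset.mem_filter.1 hcd).2
    simp only [f, Sym2.eq_iff] at this
    simpa using this
  have hedge : H.edgeSet = (D.image f : Finset (Sym2 V)) := by
    ext e
    induction e with
    | _ a b =>
      simp only [H, D, f, SimpleGraph.Subgraph.mem_edgeSet, SimpleGraph.Subgraph.induce_adj,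
        SimpleGraph.Subgraph.top_adj, Finset.coe_image, Set.mem_image, Finset.mem_coe,
        Finset.mem_filter, Finset.mem_product, Prod.exists, Sym2.eq_iff]
      constructor
      · rintro ⟨ha, hb, hab⟩
        exact ⟨a, b, ⟨⟨ha, hb⟩, hab⟩, Or.inl ⟨rfl, rfl⟩⟩
      · rintro ⟨c, d, ⟨⟨hc, hd⟩, hcd⟩, ⟨rfl, rfl⟩ | ⟨rfl, rfl⟩⟩
        exacts [⟨hc, hd, hcd⟩, ⟨hd, hc, hcd.symm⟩]
  rw [hedge, Set.ncard_coe_finset] at hH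
  have hv : H.verts.ncard = W.card := Set.ncard_coe_finset W
  rw [hv] at hH
  have : 2 * (D.image f).card < 6 * W.card := by exact_mod_cast hH
  omega

/-- `φ` is an incidence coloring of the subgraph of `G` induced by `W` in which every vertex sees
at most five colors on its incoming incidences. -/
structure IsPartialColoring (G : SimpleGraph V) [DecidableRel G.Adj] (W : Finset V) {n : ℕ}
    (φ : V → V → Fin n) : Prop where
  out_ne : ∀ ⦃v u w⦄, v ∈ W → u ∈ W → w ∈ W → G.Adj v u → G.Adj v w → u ≠ w → φ v u ≠ φ v w
  path_ne : ∀ ⦃v u w⦄, v ∈ W → u ∈ W → w ∈ W → G.Adj v u → G.Adj u w → φ v u ≠ φ u w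
  card_in_le : ∀ v ∈ W, ((W.filter (G.Adj v)).image fun u => φ u v).card ≤ 5

lemma IsPartialColoring.exists_insert [Fintype V] {D : ℕ}
    (hdeg : ∀ v, G.degree v ≤ D) {W : Finset V} {v : V} (hv : v ∉ W)
    (h5 : (W.filter (G.Adj v)).card ≤ 5) {φ : V → V → Fin (D + 7)}
    (hφ : IsPartialColoring G W φ) :
    ∃ ψ : V → V → Fin (D + 7), IsPartialColoring G (insert v W) ψ := by
  let inC : V → Finset (Fin (D + 7)) := fun u => (W.filter (G.Adj u)).image fun w => φ w u
  let outC : V → Finset (Fin (D + 7)) := fun u => (W.filter (G.Adj u)).image (φ u)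
  let ι := {u // u ∈ W.filter (G.Adj v)}
  have hι : ∀ u : ι, u.1 ∈ W ∧ G.Adj v u.1 := fun u => Finset.mem_filter.1 u.2
  have hchoice : ∀ u : ι, ∃ B C : Finset (Fin (D + 7)), B.card = 5 ∧ C.card = 3 ∧ Disjoint B C ∧
      inC u ⊆ B ∧ Disjoint B (outC u) ∧ Disjoint C (outC u) := by
    intro u
    obtain ⟨huW, huv⟩ := hι u
    have hin : (inC u).card ≤ 5 := hφ.card_in_le u huW
    have hout : (outC u).card + 1 ≤ D := by
      refine le_trans ?_ (hdeg u)
      rw [← G.card_neighborFinset_eq_degree]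
      refine (Nat.succ_le_succ Finset.card_image_le).trans
        (Finset.card_lt_card (Finset.ssubset_iff_of_subset ?_ |>.2 ⟨v, ?_, ?_⟩))
      · intro w hw
        simpa using (Finset.mem_filter.1 hw).2
      · simpa using huv.symm
      · simp [hv]
    have hdis : inC u ⊆ (outC u)ᶜ := by
      intro c hc
      simp only [inC, outC, Finset.mem_compl, Finset.mem_image, Finset.mem_filter] at hc ⊢
      rintro ⟨w, ⟨hw, huw⟩, rfl⟩
      obtain ⟨w', ⟨hw', huw'⟩, he⟩ := hc
      exact hφ.path_ne hw' huW hw huw'.symm huw he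
    have hcard := Finset.card_add_card_compl (outC u)
    rw [Fintype.card_fin] at hcard
    obtain ⟨B, hB1, hB2, hB⟩ := Finset.exists_subsuperset_card_eq hdis hin (by omega)
    obtain ⟨C, hC1, hC⟩ := Finset.exists_subset_card_eq
      (show 3 ≤ ((outC u)ᶜ \ B).card by rw [Finset.card_sdiff_of_subset hB2]; omega)
    refine ⟨B, C, hB, hC, ?_, hB1, ?_, ?_⟩
    · exact (Finset.disjoint_sdiff).mono_right hC1
    · exact Finset.disjoint_left.2 fun c hc => by simpa using hB2 hc
    · exact Finset.disjoint_left.2 fun c hc => by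
        simpa using (Finset.mem_sdiff.1 (hC1 hc)).1
  choose B C hB hC hBC hinB hBout hCout using hchoice
  obtain ⟨x, y, hx, hxB, hyC, hxy⟩ := CompatibleChoice.of_card_of_card_le_five
    (by rwa [Fintype.card_coe]) hB hC hBC
  have hmem : ∀ {u}, u ∈ insert v W → G.Adj v u → u ∈ W.filter (G.Adj v) := by
    intro u hu huv
    rcases Finset.mem_insert.1 hu with rfl | hu
    · exact absurd huv G.irrefl
    · simp [hu, huv]
  let ψ : V → V → Fin (D + 7) := fun a b =>
    if a = v then (if h : b ∈ W.filter (G.Adj v) then x ⟨b, h⟩ else 0)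
    else if b = v then (if h : a ∈ W.filter (G.Adj v) then y ⟨a, h⟩ else 0)
    else φ a b
  have ψ1 : ∀ (u : V) (h : u ∈ W.filter (G.Adj v)), ψ v u = x ⟨u, h⟩ := by
    intro u h
    simp only [ψ, if_true, dif_pos h]
  have ψ2 : ∀ (u : V) (h : u ∈ W.filter (G.Adj v)), ψ u v = y ⟨u, h⟩ := by
    intro u h
    have hu : u ≠ v := by rintro rfl; exact hv (Finset.mem_filter.1 h).1
    simp only [ψ, if_neg hu, if_true, dif_pos h]
  have ψ3 : ∀ a b, a ≠ v → b ≠ v → ψ a b = φ a b := by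
    intro a b ha hb
    simp only [ψ, if_neg ha, if_neg hb]
  have hW : ∀ {u}, u ∈ insert v W → u ≠ v → u ∈ W := fun hu hne =>
    (Finset.mem_insert.1 hu).resolve_left hne
  have houtmem : ∀ {u w}, u ∈ W → w ∈ W → G.Adj u w → φ u w ∈ outC u := by
    intro u w _ hw huw
    exact Finset.mem_image_of_mem _ (by simp [hw, huw])
  have hinmem : ∀ {u w}, u ∈ W → w ∈ W → G.Adj u w → φ u w ∈ inC w := by
    intro u w hu _ huw
    exact Finset.mem_image.2 ⟨u, by simp [hu, huw.symm], rfl⟩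
  refine ⟨ψ, ?_, ?_, ?_⟩
  · intro a b c ha hb hc hab hac hbc
    by_cases hav : a = v
    · subst hav
      rw [ψ1 b (hmem hb hab), ψ1 c (hmem hc hac)]
      exact fun h => hbc (congrArg Subtype.val (hx h))
    · have key : ∀ c, c ∈ insert v W → G.Adj a c → c ≠ v → G.Adj a v → ψ a v ≠ ψ a c := by
        intro c hc hac hcv hav'
        rw [ψ2 a (hmem ha hav'.symm), ψ3 a c hav hcv]
        exact fun h => Finset.disjoint_left.1 (hCout _) (hyC _)
          (h ▸ houtmem (hW ha hav) (hW hc hcv) hac)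
      by_cases hbv : b = v
      · subst hbv
        exact key c hc hac hbc.symm hab
      · by_cases hcv : c = v
        · subst hcv
          exact (key b hb hab hbv hac).symm
        · rw [ψ3 a b hav hbv, ψ3 a c hav hcv]
          exact hφ.out_ne (hW ha hav) (hW hb hbv) (hW hc hcv) hab hac hbc
  · intro a b c ha hb hc hab hbc
    by_cases hbv : b = v
    · subst hbv
      rw [ψ2 a (hmem ha hab.symm), ψ1 c (hmem hc hbc)]
      exact (hxy _ _).symm
    · by_cases hav : a = v
      · subst hav
        rw [ψ1 b (hmem hb hab)]
        by_cases hca : c = a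
        · subst hca
          rw [ψ2 b (hmem hb hab)]
          exact hxy _ _
        · rw [ψ3 b c hbv hca]
          exact fun h => Finset.disjoint_left.1 (hBout _) (hxB _)
            (h ▸ houtmem (hW hb hbv) (hW hc hca) hbc)
      · rw [ψ3 a b hav hbv]
        by_cases hcv : c = v
        · subst hcv
          rw [ψ2 b (hmem hb hbc.symm)]
          exact fun h => Finset.disjoint_left.1 (hBC ⟨b, hmem hb hbc.symm⟩)
            (hinB _ (hinmem (hW ha hav) (hW hb hbv) hab)) (h ▸ hyC _)
        · rw [ψ3 b c hbv hcv]
          exact hφ.path_ne (hW ha hav) (hW hb hbv) (hW hc hcv) hab hbc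
  · intro a ha
    by_cases hav : a = v
    · subst hav
      refine Finset.card_image_le.trans ((Finset.card_le_card fun u hu => ?_).trans h5)
      obtain ⟨hu, hau⟩ := Finset.mem_filter.1 hu
      exact hmem hu hau
    · by_cases hadj : G.Adj v a
      · refine (Finset.card_le_card (t := B ⟨a, hmem ha hadj⟩) fun c hc => ?_).trans (hB _).le
        obtain ⟨u, hu, rfl⟩ := Finset.mem_image.1 hc
        obtain ⟨hu, hau⟩ := Finset.mem_filter.1 hu
        by_cases huv : u = v
        · subst huv
          rw [ψ1 a (hmem ha hadj)]
          exact hxB _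
        · rw [ψ3 u a huv hav]
          exact hinB _ (hinmem (hW hu huv) (hW ha hav) hau.symm)
      · refine (Finset.card_le_card fun c hc => ?_).trans (hφ.card_in_le a (hW ha hav))
        obtain ⟨u, hu, rfl⟩ := Finset.mem_image.1 hc
        obtain ⟨hu, hau⟩ := Finset.mem_filter.1 hu
        have huv : u ≠ v := by rintro rfl; exact hadj hau.symm
        rw [ψ3 u a huv hav]
        exact hinmem (hW hu huv) (hW ha hav) hau.symm

lemma MadLT.exists_isPartialColoring [Fintype V] (hmad : MadLT G 6) {D : ℕ}
    (hdeg : ∀ v, G.degree v ≤ D) (W : Finset V) :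
    ∃ φ : V → V → Fin (D + 7), IsPartialColoring G W φ := by
  induction W using Finset.strongInduction with
  | H W ih =>
    rcases W.eq_empty_or_nonempty with rfl | hW
    · exact ⟨fun _ _ => 0, by simp, by simp, by simp⟩
    · obtain ⟨v, hvW, hv5⟩ := hmad.exists_degree_le_five hW
      obtain ⟨φ, hφ⟩ := ih (W.erase v) (Finset.erase_ssubset hvW)
      rw [← Finset.insert_erase hvW]
      refine hφ.exists_insert hdeg (Finset.notMem_erase v W)
        ((Finset.card_le_card ?_).trans hv5)
      exact Finset.filter_subset_filter _ (Finset.erase_subset v W)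

end Degeneracy

lemma IsPartialColoring.isIncidenceColoring {V : Type*} [Fintype V] {G : SimpleGraph V}
    [DecidableRel G.Adj] {n : ℕ} {φ : V → V → Fin n}
    (hφ : IsPartialColoring G Finset.univ φ) : IsIncidenceColoring G φ := by
  have out_ne := fun v u w => hφ.out_ne (Finset.mem_univ v) (Finset.mem_univ u) (Finset.mem_univ w)
  have path_ne := fun v u w =>
    hφ.path_ne (Finset.mem_univ v) (Finset.mem_univ u) (Finset.mem_univ w)
  intro v u w x hvu hwx hne h
  simp only [Sym2.eq_iff] at h
  rcases h with rfl | (⟨rfl, rfl⟩ | ⟨rfl, rfl⟩) | (⟨-, rfl⟩ | ⟨rfl, -⟩) | (⟨rfl, rfl⟩ | ⟨rfl, -⟩)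
  · exact out_ne _ _ _ hvu hwx fun h => hne (by rw [h])
  · exact absurd rfl hne
  · exact path_ne _ _ _ hvu hwx
  · exact path_ne _ _ _ hvu hwx
  · exact absurd hvu G.irrefl
  · exact absurd hwx G.irrefl
  · exact (path_ne _ _ _ hwx hvu).symm

theorem incidence_chromatic_mad_lt_six_mid_degree {V : Type*} [Fintype V] (G : SimpleGraph V)
    [DecidableRel G.Adj] (hmad : MadLT G 6) (hΔ1 : 7 ≤ G.maxDegree) (hΔ2 : G.maxDegree ≤ 11) :
    incChromaticNumber G ≤ G.maxDegree + 7 := by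
  classical
  obtain ⟨φ, hφ⟩ := hmad.exists_isPartialColoring G.degree_le_maxDegree Finset.univ
  exact Nat.sInf_le ⟨φ, hφ.isIncidenceColoring⟩
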